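/- arXiv:2010.01470 — 3 statements merged into one kernel-verified Lean document; each statement's English description precedes it below -/
import Mathlib

section
/- There exists a non-degenerate ranking problem and a strictly increasing concave function f : ℝ → ℝ such that under every ranking policy π maximizing the user fairness UF(π) over all ranking policies, items are not ranked by expected relevance within each item group. -/
open Finset

/-- A ranking problem in a two-sided market: finite nonempty sets of items, intents,
user groups; a partition of the items into item groups; group proportions; per-group
intent distributions; a nonnegative relevance function; and a nonnegative exposure
function on positions with positive total exposure. -/
structure RankingProblem where
  Item : Type
  Intent : Type
  UserGrp : Type
  ItemGrp : Type
  [itemFin : Fintype Item]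
  [itemDec : DecidableEq Item]
  [intentFin : Fintype Intent]
  [userFin : Fintype UserGrp]
  [itemGrpFin : Fintype ItemGrp]
  [itemGrpDec : DecidableEq ItemGrp]
  [itemNe : Nonempty Item]
  [intentNe : Nonempty Intent]
  [userNe : Nonempty UserGrp]
  /-- group proportion of each user group -/
  ρ : UserGrp → ℝ
  ρ_nonneg : ∀ g, 0 ≤ ρ g
  ρ_sum : ∑ g, ρ g = 1
  /-- the item group of each item; this partitions the items, each group being nonempty -/
  grp : Item → ItemGrp
  grp_surj : Function.Surjective grp
  /-- intent distribution of each user group -/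
  intentDist : UserGrp → Intent → ℝ
  intentDist_nonneg : ∀ g i, 0 ≤ intentDist g i
  intentDist_sum : ∀ g, ∑ i, intentDist g i = 1
  /-- relevance of each item to each intent -/
  rel : Item → Intent → ℝ
  rel_nonneg : ∀ d i, 0 ≤ rel d i
  /-- exposure of each position -/
  expo : Fin (Fintype.card Item) → ℝ
  expo_nonneg : ∀ n, 0 ≤ expo n
  expo_sum_pos : 0 < ∑ n, expo n

attribute [instance] RankingProblem.itemFin RankingProblem.itemDec
  RankingProblem.intentFin RankingProblem.userFin RankingProblem.itemGrpFin
  RankingProblem.itemGrpDec RankingProblem.itemNe RankingProblem.intentNe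
  RankingProblem.userNe

namespace RankingProblem

variable (P : RankingProblem)

/-- A ranking is a bijection from items onto positions. -/
abbrev Ranking := P.Item ≃ Fin (Fintype.card P.Item)

/-- The overall intent distribution I_U(i) = Σ_UG ρ_UG · I_UG(i). -/
noncomputable def overallIntent (i : P.Intent) : ℝ := ∑ g, P.ρ g * P.intentDist g i

/-- Utility of a ranking for an intent: U(σ|i) = Σ_d e(σ(d))·r(d,i). -/
noncomputable def intentUtil (σ : P.Ranking) (i : P.Intent) : ℝ :=
  ∑ d, P.expo (σ d) * P.rel d i

/-- A ranking policy: a (finitely supported) probability distribution over rankings. -/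
def IsPolicy (π : P.Ranking → ℝ) : Prop := (∀ σ, 0 ≤ π σ) ∧ ∑ σ, π σ = 1

/-- Utility of a policy for a user group. -/
noncomputable def groupUtil (π : P.Ranking → ℝ) (g : P.UserGrp) : ℝ :=
  ∑ σ, π σ * ∑ i, P.intentDist g i * P.intentUtil σ i

/-- Overall utility of a policy. -/
noncomputable def utility (π : P.Ranking → ℝ) : ℝ := ∑ g, P.ρ g * P.groupUtil π g

/-- Utility of a policy for an item group. -/
noncomputable def itemGroupUtil (π : P.Ranking → ℝ) (dg : P.ItemGrp) : ℝ :=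
  ∑ σ, π σ * ∑ i, P.overallIntent i *
    ∑ d ∈ univ.filter (fun d => P.grp d = dg), P.expo (σ d) * P.rel d i

/-- Average exposure of an item group under a policy. -/
noncomputable def groupExposure (π : P.Ranking → ℝ) (dg : P.ItemGrp) : ℝ :=
  (∑ σ, π σ * ∑ d ∈ univ.filter (fun d => P.grp d = dg), P.expo (σ d)) /
    (univ.filter (fun d => P.grp d = dg)).card

/-- Expected relevance of an item to the whole user population. -/
noncomputable def expRel (d : P.Item) : ℝ := ∑ i, P.overallIntent i * P.rel d i

/-- Non-degeneracy of a ranking problem. -/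
def NonDegenerate : Prop :=
  (∀ g, 0 < P.ρ g) ∧ (∀ i, 0 < P.overallIntent i) ∧
    (∀ i, ∃ d, 0 < P.rel d i) ∧ (∀ dg, ∃ d, P.grp d = dg ∧ 0 < P.expRel d)

/-- The amount of intent covered by a ranking. -/
noncomputable def coverage (σ : P.Ranking) : ℝ :=
  ∑ i ∈ univ.filter (fun i => 0 < P.intentUtil σ i), P.overallIntent i

instance : Nonempty P.Ranking := ⟨Fintype.equivFin P.Item⟩

/-- The maximum amount of intent coverable by any ranking. -/
noncomputable def maxCoverage : ℝ := ⨆ σ : P.Ranking, P.coverage σ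

/-- Items are ranked by expected relevance within each item group under π. -/
def RankedByExpRel (π : P.Ranking → ℝ) : Prop :=
  ∀ σ, 0 < π σ → ∀ dm dn, P.grp dm = P.grp dn → P.expRel dn < P.expRel dm →
    P.expo (σ dn) ≤ P.expo (σ dm)

/-- User fairness of a policy with respect to a concave increasing function f. -/
noncomputable def userFairness (f : ℝ → ℝ) (π : P.Ranking → ℝ) : ℝ :=
  ∑ g, P.ρ g * f (P.groupUtil π g)

/-- Diversity of a single ranking with respect to a concave increasing function g. -/
noncomputable def rankDiversity (gf : ℝ → ℝ) (σ : P.Ranking) : ℝ :=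
  ∑ i, P.overallIntent i * gf (P.intentUtil σ i)

/-- Diversity of a policy. -/
noncomputable def diversity (gf : ℝ → ℝ) (π : P.Ranking → ℝ) : ℝ :=
  ∑ σ, π σ * P.rankDiversity gf σ

/-- π maximizes the overall utility over all ranking policies. -/
def MaxUtil (π : P.Ranking → ℝ) : Prop :=
  P.IsPolicy π ∧ ∀ π', P.IsPolicy π' → P.utility π' ≤ P.utility π

/-- π maximizes user fairness over all ranking policies. -/
def MaxUF (f : ℝ → ℝ) (π : P.Ranking → ℝ) : Prop :=
  P.IsPolicy π ∧ ∀ π', P.IsPolicy π' → P.userFairness f π' ≤ P.userFairness f π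

/-- π maximizes diversity over all ranking policies. -/
def MaxDiv (gf : ℝ → ℝ) (π : P.Ranking → ℝ) : Prop :=
  P.IsPolicy π ∧ ∀ π', P.IsPolicy π' → P.diversity gf π' ≤ P.diversity gf π

/-- π satisfies the disparate treatment constraints with merit function M. -/
def SatDT (M : P.ItemGrp → ℝ) (π : P.Ranking → ℝ) : Prop :=
  ∀ dg1 dg2, P.groupExposure π dg1 / M dg1 = P.groupExposure π dg2 / M dg2

/-- π maximizes overall utility among policies satisfying the disparate treatment
constraints with merit function M. -/
def MaxUtilDT (M : P.ItemGrp → ℝ) (π : P.Ranking → ℝ) : Prop :=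
  P.IsPolicy π ∧ P.SatDT M π ∧
    ∀ π', P.IsPolicy π' → P.SatDT M π' → P.utility π' ≤ P.utility π

/-- π dominates π' for the user groups. -/
def DominatesUsers (π π' : P.Ranking → ℝ) : Prop :=
  (∀ g, P.groupUtil π' g ≤ P.groupUtil π g) ∧ ∃ g, P.groupUtil π' g < P.groupUtil π g

/-- π is Pareto efficient for the user groups. -/
def ParetoUsers (π : P.Ranking → ℝ) : Prop :=
  ¬ ∃ π', P.IsPolicy π' ∧ P.DominatesUsers π' π

/-- σ dominates σ' for the intents. -/
def DominatesIntents (σ σ' : P.Ranking) : Prop :=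
  (∀ i, P.intentUtil σ' i ≤ P.intentUtil σ i) ∧ ∃ i, P.intentUtil σ' i < P.intentUtil σ i

/-- σ is Pareto efficient for the intents. -/
def ParetoIntents (σ : P.Ranking) : Prop := ¬ ∃ σ', P.DominatesIntents σ' σ

end RankingProblem
/-- Two items, two intents, two user groups, one item group, exposure only at the top. -/
noncomputable def exProblem : RankingProblem where
  Item := Fin 2
  Intent := Fin 2
  UserGrp := Fin 2
  ItemGrp := Unit
  ρ := fun g => if g = 0 then 2 / 3 else 1 / 3
  ρ_nonneg := by intro g; split_ifs <;> norm_num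
  ρ_sum := by rw [Fin.sum_univ_two]; norm_num
  grp := fun _ => ()
  grp_surj := fun _ => ⟨0, rfl⟩
  intentDist := fun g i => if g = i then 1 else 0
  intentDist_nonneg := by intro g i; split_ifs <;> norm_num
  intentDist_sum := by intro g; simp
  rel := fun d i => if d = i then 1 else 0
  rel_nonneg := by intro d i; split_ifs <;> norm_num
  expo := fun n => if n.val = 0 then 1 else 0
  expo_nonneg := by intro n; split_ifs <;> norm_num
  expo_sum_pos := by
    change 0 < ∑ n : Fin 2, (if n.val = 0 then (1 : ℝ) else 0)
    rw [Fin.sum_univ_two]; norm_num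

/-- A concave strictly increasing function. -/
noncomputable def exF (x : ℝ) : ℝ := min (10 * x) (x + 1)

lemma exF_strictMono : StrictMono exF := by
  intro x y h
  exact min_lt_min (by linarith) (by linarith)

lemma exF_concave : ConcaveOn ℝ Set.univ exF := by
  refine ⟨convex_univ, ?_⟩
  intro x _ y _ a b ha hb hab
  simp only [exF, smul_eq_mul]
  have h1 := min_le_left (10 * x) (x + 1)
  have h2 := min_le_right (10 * x) (x + 1)
  have h3 := min_le_left (10 * y) (y + 1)
  have h4 := min_le_right (10 * y) (y + 1)
  apply le_min
  · have := mul_le_mul_of_nonneg_left h1 ha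
    have := mul_le_mul_of_nonneg_left h3 hb
    linarith
  · have := mul_le_mul_of_nonneg_left h2 ha
    have := mul_le_mul_of_nonneg_left h4 hb
    linarith

/-- Group utility in the example. -/
lemma ex_groupUtil (π : exProblem.Ranking → ℝ) (g : Fin 2) :
    exProblem.groupUtil π g
      = ∑ σ : exProblem.Ranking, π σ * exProblem.expo (σ g) := by
  unfold RankingProblem.groupUtil
  refine Finset.sum_congr rfl fun σ _ => ?_
  congr 1
  change ∑ i : Fin 2, (if g = i then (1 : ℝ) else 0) *
    (∑ d : Fin 2, exProblem.expo (σ d) * (if d = i then (1 : ℝ) else 0)) = _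
  simp

lemma ex_userFairness (f : ℝ → ℝ) (π : exProblem.Ranking → ℝ) :
    exProblem.userFairness f π
      = 2 / 3 * f (exProblem.groupUtil π (0 : Fin 2))
        + 1 / 3 * f (exProblem.groupUtil π (1 : Fin 2)) := by
  change ∑ g : Fin 2, (if g = 0 then (2 / 3 : ℝ) else 1 / 3) * f (exProblem.groupUtil π g) = _
  rw [Fin.sum_univ_two]; simp

lemma ex_overall (i : Fin 2) :
    exProblem.overallIntent i = if i = 0 then 2 / 3 else 1 / 3 := by
  change ∑ g : Fin 2, (if g = 0 then (2 / 3 : ℝ) else 1 / 3) * (if g = i then 1 else 0) = _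
  simp

lemma ex_expRel (d : Fin 2) :
    exProblem.expRel d = if d = 0 then 2 / 3 else 1 / 3 := by
  change ∑ i : Fin 2, exProblem.overallIntent i * (if d = i then (1 : ℝ) else 0) = _
  simp [ex_overall]

lemma ex_expo (n : Fin 2) :
    exProblem.expo n = if n = 0 then 1 else 0 := by
  change (if n.val = 0 then (1 : ℝ) else 0) = _
  have h : n.val = 0 ↔ n = 0 := (Fin.ext_iff (a := n) (b := 0)).symm
  exact if_congr h rfl rfl

/-- The ranking putting item 0 on top. -/
noncomputable def exS : exProblem.Ranking := Equiv.refl (Fin 2)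

/-- The ranking putting item 1 on top. -/
noncomputable def exT : exProblem.Ranking := (Equiv.swap 0 1 : Fin 2 ≃ Fin 2)

open Classical in
/-- The uniform mixture of both rankings. -/
noncomputable def exPol (σ : exProblem.Ranking) : ℝ :=
  (if σ = exS then 1 / 2 else 0) + (if σ = exT then 1 / 2 else 0)

lemma exPol_sum (h : exProblem.Ranking → ℝ) :
    ∑ σ, exPol σ * h σ = 1 / 2 * h exS + 1 / 2 * h exT := by
  simp [exPol, add_mul, Finset.sum_add_distrib, ite_mul]

lemma exPol_isPolicy : exProblem.IsPolicy exPol := by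
  constructor
  · intro σ
    unfold exPol
    split_ifs <;> norm_num
  · have := exPol_sum (fun _ => 1)
    simp only [mul_one] at this
    rw [this]; norm_num

lemma exPol_util (g : Fin 2) : exProblem.groupUtil exPol g = 1 / 2 := by
  rw [ex_groupUtil, exPol_sum]
  have h1 : exProblem.expo (exS g) = if g = 0 then 1 else 0 := ex_expo g
  have h2 : exProblem.expo (exT g) = if (Equiv.swap (0 : Fin 2) 1 g) = 0 then 1 else 0 :=
    ex_expo (Equiv.swap (0 : Fin 2) 1 g)
  rw [h1, h2]
  fin_cases g <;> simp

lemma exPol_UF : exProblem.userFairness exF exPol = 3 / 2 := by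
  rw [ex_userFairness, exPol_util, exPol_util]
  norm_num [exF]

lemma ex_ranked (π : exProblem.Ranking → ℝ) (hp : exProblem.IsPolicy π)
    (hr : exProblem.RankedByExpRel π) : exProblem.userFairness exF π ≤ 4 / 3 := by
  have hle (n) : exProblem.expo n ≤ 1 := by
    rw [ex_expo n]; split_ifs <;> norm_num
  have h0 : exProblem.groupUtil π (0 : Fin 2) ≤ 1 := by
    rw [ex_groupUtil, ← hp.2]
    exact Finset.sum_le_sum fun σ _ => mul_le_of_le_one_right (hp.1 σ) (hle _)
  have h1 : exProblem.groupUtil π (1 : Fin 2) = 0 := by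
    rw [ex_groupUtil]
    refine Finset.sum_eq_zero fun σ _ => ?_
    rcases (hp.1 σ).eq_or_lt with h | h
    · rw [← h, zero_mul]
    · have hlt : exProblem.expRel (1 : Fin 2) < exProblem.expRel (0 : Fin 2) := by
        rw [ex_expRel, ex_expRel]; norm_num
      have hx := hr σ h (0 : Fin 2) (1 : Fin 2) rfl hlt
      have hne : σ (0 : Fin 2) ≠ σ (1 : Fin 2) := by
        intro e
        have e' : (0 : Fin 2) = 1 := σ.injective e
        exact absurd e' (by decide)
      have key : ∀ a b : Fin 2, a ≠ b → exProblem.expo b ≤ exProblem.expo a →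
          exProblem.expo b = 0 := by
        intro a b hab hba
        rw [ex_expo, ex_expo] at hba
        rw [ex_expo]
        by_cases hb : b = 0
        · have ha : a ≠ 0 := fun h => hab (h.trans hb.symm)
          rw [if_pos hb, if_neg ha] at hba
          linarith
        · rw [if_neg hb]
      rw [key _ _ hne hx, mul_zero]
  rw [ex_userFairness, h1]
  have := exF_strictMono.monotone h0
  have e1 : exF 1 = 2 := by norm_num [exF]
  have e0 : exF 0 = 0 := by norm_num [exF]
  rw [e1] at this
  rw [e0]
  linarith

lemma ex_nondeg : exProblem.NonDegenerate := by
  refine ⟨?_, ?_, ?_, ?_⟩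
  · intro g
    change 0 < (if (show Fin 2 from g) = 0 then (2 / 3 : ℝ) else 1 / 3)
    split_ifs <;> norm_num
  · intro i
    rw [ex_overall i]
    split_ifs <;> norm_num
  · intro i
    refine ⟨i, ?_⟩
    have h : ∀ j : Fin 2, (0 : ℝ) < (if j = j then (1 : ℝ) else 0) := by
      intro j; simp
    exact h i
  · intro dg
    refine ⟨(0 : Fin 2), rfl, ?_⟩
    rw [ex_expRel]; norm_num

/-- There exist a non-degenerate ranking problem and a strictly increasing concave f
such that under every policy maximizing user fairness, items are not ranked by
expected relevance within each item group. -/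
theorem stmt3 :
    ∃ (P : RankingProblem) (f : ℝ → ℝ), P.NonDegenerate ∧ StrictMono f ∧
      ConcaveOn ℝ Set.univ f ∧
      ∀ π : P.Ranking → ℝ, P.MaxUF f π → ¬ P.RankedByExpRel π := by
  refine ⟨exProblem, exF, ex_nondeg, exF_strictMono, exF_concave, ?_⟩
  intro π hm hr
  have h1 := hm.2 exPol exPol_isPolicy
  have h2 := ex_ranked π hm.1 hr
  rw [exPol_UF] at h1
  linarith
end

section
/- For every non-degenerate ranking problem, there exists a merit function M such that the disparate treatment constraints with merit M are satisfied by at least one ranking policy, and every ranking policy π that maximizes the overall utility U(π) among all policies satisfying the disparate treatment constraints has U(π|DG) > 0 for every item group DG. -/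
open Finset

namespace RankingProblem

/-- Expected exposure of an item. -/
noncomputable def xExp (P : RankingProblem) (π : P.Ranking → ℝ) (d : P.Item) : ℝ :=
  ∑ σ, π σ * P.expo (σ d)

lemma xExp_nonneg (P : RankingProblem) (π : P.Ranking → ℝ) (h : P.IsPolicy π) (d : P.Item) :
    0 ≤ P.xExp π d :=
  Finset.sum_nonneg fun σ _ => mul_nonneg (h.1 σ) (P.expo_nonneg _)

lemma itemGroupUtil_eq (P : RankingProblem) (π : P.Ranking → ℝ) (dg : P.ItemGrp) :
    P.itemGroupUtil π dg =
      ∑ d ∈ univ.filter (fun d => P.grp d = dg), P.xExp π d * P.expRel d := by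
  unfold itemGroupUtil xExp expRel
  simp_rw [Finset.sum_mul_sum, Finset.mul_sum]
  rw [Finset.sum_comm (s := univ.filter (fun d => P.grp d = dg))]
  refine Finset.sum_congr rfl fun σ _ => ?_
  rw [Finset.sum_comm]
  refine Finset.sum_congr rfl fun d _ => ?_
  refine Finset.sum_congr rfl fun i _ => ?_
  ring

lemma utility_eq (P : RankingProblem) (π : P.Ranking → ℝ) :
    P.utility π = ∑ d, P.xExp π d * P.expRel d := by
  have h1 : P.utility π = ∑ σ, ∑ i, ∑ d, ∑ g,
      P.ρ g * (π σ * (P.intentDist g i * (P.expo (σ d) * P.rel d i))) := by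
    unfold utility groupUtil intentUtil
    simp_rw [Finset.mul_sum]
    rw [Finset.sum_comm]
    refine Finset.sum_congr rfl fun σ _ => ?_
    rw [Finset.sum_comm]
    refine Finset.sum_congr rfl fun i _ => ?_
    rw [Finset.sum_comm]
  have h2 : ∑ d, P.xExp π d * P.expRel d = ∑ d, ∑ σ, ∑ i, ∑ g,
      P.ρ g * (π σ * (P.intentDist g i * (P.expo (σ d) * P.rel d i))) := by
    unfold xExp expRel overallIntent
    simp_rw [Finset.sum_mul_sum, Finset.sum_mul, Finset.mul_sum]
    refine Finset.sum_congr rfl fun d _ => ?_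
    refine Finset.sum_congr rfl fun σ _ => ?_
    refine Finset.sum_congr rfl fun i _ => ?_
    refine Finset.sum_congr rfl fun g _ => ?_
    ring
  rw [h1, h2, Finset.sum_comm (s := (univ : Finset P.Item))]
  refine Finset.sum_congr rfl fun σ _ => ?_
  rw [Finset.sum_comm]

lemma groupExposure_eq (P : RankingProblem) (π : P.Ranking → ℝ) (dg : P.ItemGrp) :
    P.groupExposure π dg = (∑ d ∈ univ.filter (fun d => P.grp d = dg), P.xExp π d) /
      (univ.filter (fun d => P.grp d = dg)).card := by
  unfold groupExposure xExp
  congr 1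
  simp_rw [Finset.mul_sum]
  rw [Finset.sum_comm]

lemma xExp_sum (P : RankingProblem) (π : P.Ranking → ℝ) (h : P.IsPolicy π) :
    ∑ d, P.xExp π d = ∑ n, P.expo n := by
  unfold xExp
  rw [Finset.sum_comm]
  simp_rw [← Finset.mul_sum, Equiv.sum_comp]
  rw [← Finset.sum_mul, h.2, one_mul]

/-- Relabel the items of all rankings by a permutation. -/
def permute (P : RankingProblem) (τ : Equiv.Perm P.Item) (π : P.Ranking → ℝ) : P.Ranking → ℝ :=
  fun σ => π (τ.trans σ)

/-- The induced permutation of rankings. -/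
def permR (P : RankingProblem) (τ : Equiv.Perm P.Item) : P.Ranking ≃ P.Ranking where
  toFun σ := τ.trans σ
  invFun σ := τ.symm.trans σ
  left_inv σ := by ext; simp
  right_inv σ := by ext; simp

lemma permute_policy (P : RankingProblem) (τ : Equiv.Perm P.Item) (π : P.Ranking → ℝ)
    (h : P.IsPolicy π) : P.IsPolicy (P.permute τ π) :=
  ⟨fun _ => h.1 _, ((P.permR τ).sum_comp π).trans h.2⟩

lemma xExp_permute (P : RankingProblem) (τ : Equiv.Perm P.Item) (π : P.Ranking → ℝ)
    (d : P.Item) : P.xExp (P.permute τ π) (τ d) = P.xExp π d := by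
  unfold xExp
  rw [← (P.permR τ).sum_comp (fun σ => π σ * P.expo (σ d))]
  rfl

end RankingProblem

theorem stmt11 (P : RankingProblem) (hP : P.NonDegenerate) :
    ∃ M : P.ItemGrp → ℝ, (∀ dg, 0 < M dg) ∧
      (∃ π0 : P.Ranking → ℝ, P.IsPolicy π0 ∧ P.SatDT M π0) ∧
      ∀ π : P.Ranking → ℝ, P.MaxUtilDT M π → ∀ dg, 0 < P.itemGroupUtil π dg := by
  have hcard : ∀ dg, ((univ.filter (fun d => P.grp d = dg)).card : ℝ) ≠ 0 := by
    intro dg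
    obtain ⟨d, hd⟩ := P.grp_surj dg
    have : (univ.filter (fun d => P.grp d = dg)).Nonempty := ⟨d, by simp [hd]⟩
    exact_mod_cast this.card_pos.ne'
  refine ⟨fun _ => 1, fun _ => one_pos, ?_, ?_⟩
  · refine ⟨fun _ => 1 / (Fintype.card P.Ranking : ℝ), ⟨fun _ => by positivity, ?_⟩, ?_⟩
    · have : (Fintype.card P.Ranking : ℝ) ≠ 0 := by exact_mod_cast Fintype.card_ne_zero
      rw [Finset.sum_const, Finset.card_univ, nsmul_eq_mul]
      field_simp
    · obtain ⟨d0⟩ := P.itemNe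
      have key : ∀ d, P.xExp (fun _ => 1 / (Fintype.card P.Ranking : ℝ)) d =
          P.xExp (fun _ => 1 / (Fintype.card P.Ranking : ℝ)) d0 := by
        intro d
        have := P.xExp_permute (Equiv.swap d0 d) (fun _ => 1 / (Fintype.card P.Ranking : ℝ)) d0
        rw [Equiv.swap_apply_left] at this
        exact this
      have h2 : ∀ dg, P.groupExposure (fun _ => 1 / (Fintype.card P.Ranking : ℝ)) dg =
          P.xExp (fun _ => 1 / (Fintype.card P.Ranking : ℝ)) d0 := by
        intro dg
        rw [P.groupExposure_eq, Finset.sum_congr rfl fun d _ => key d, Finset.sum_const,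
          nsmul_eq_mul, mul_div_cancel_left₀ _ (hcard dg)]
      intro a b
      simp only [h2]
  · rintro π ⟨hpol, hdt, hmax⟩ dg
    by_contra hneg
    have hrel : ∀ d, 0 ≤ P.expRel d := fun d => Finset.sum_nonneg fun i _ =>
      mul_nonneg (hP.2.1 i).le (P.rel_nonneg _ _)
    have hX := P.xExp_nonneg π hpol
    rw [P.itemGroupUtil_eq] at hneg
    have hz0 := le_antisymm (not_lt.1 hneg)
      (Finset.sum_nonneg fun d _ => mul_nonneg (hX d) (hrel d))
    rw [Finset.sum_eq_zero_iff_of_nonneg fun d _ => mul_nonneg (hX d) (hrel d)] at hz0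
    have hz : ∀ d, P.grp d = dg → P.xExp π d * P.expRel d = 0 :=
      fun d hd => hz0 d (by simp [hd])
    obtain ⟨b, hb, hbpos⟩ := hP.2.2.2 dg
    have hXb : P.xExp π b = 0 := (mul_eq_zero.1 (hz b hb)).resolve_right hbpos.ne'
    have hexa : ∃ a, P.grp a = dg ∧ 0 < P.xExp π a := by
      by_contra hno
      push Not at hno
      have hdg0 : P.groupExposure π dg = 0 := by
        rw [P.groupExposure_eq, Finset.sum_eq_zero, zero_div]
        intro d hd
        exact le_antisymm (hno d (by simpa using hd)) (hX d)
      have hall : ∀ d, P.xExp π d = 0 := by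
        intro d
        have h1 := hdt (P.grp d) dg
        simp only [div_one] at h1
        rw [hdg0, P.groupExposure_eq, div_eq_zero_iff] at h1
        have h2 := h1.resolve_right (hcard _)
        rw [Finset.sum_eq_zero_iff_of_nonneg fun d _ => hX d] at h2
        exact h2 d (by simp)
      have := P.xExp_sum π hpol
      simp only [hall, Finset.sum_const_zero] at this
      exact absurd P.expo_sum_pos (by rw [← this]; exact lt_irrefl _)
    obtain ⟨a, ha, hapos⟩ := hexa
    have hva : P.expRel a = 0 := (mul_eq_zero.1 (hz a ha)).resolve_left hapos.ne'
    have hx' : ∀ d, P.xExp (P.permute (Equiv.swap a b) π) d = P.xExp π (Equiv.swap a b d) := by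
      intro d
      have := P.xExp_permute (Equiv.swap a b) π (Equiv.swap a b d)
      rwa [Equiv.swap_apply_self] at this
    have hg : ∀ d, P.grp (Equiv.swap a b d) = P.grp d := by
      intro d
      rw [Equiv.swap_apply_def]
      split_ifs with h1 h2
      · rw [h1, ha, hb]
      · rw [h2, ha, hb]
      · rfl
    have hge : ∀ g, P.groupExposure (P.permute (Equiv.swap a b) π) g = P.groupExposure π g := by
      intro g
      rw [P.groupExposure_eq, P.groupExposure_eq]
      congr 1
      simp only [hx']
      exact Finset.sum_equiv (Equiv.swap a b) (by simp [hg]) (by simp)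
    have hle := hmax (P.permute (Equiv.swap a b) π) (P.permute_policy _ _ hpol)
      (fun x y => by rw [hge, hge]; exact hdt x y)
    rw [P.utility_eq, P.utility_eq] at hle
    refine absurd hle (not_le.2 ?_)
    refine Finset.sum_lt_sum (fun d _ => ?_) ⟨b, Finset.mem_univ _, ?_⟩
    · rw [hx', Equiv.swap_apply_def]
      split_ifs with h1 h2
      · rw [h1, hva]; simp
      · rw [h2, hXb, zero_mul]; positivity
      · exact le_rfl
    · rw [hx', Equiv.swap_apply_right, hXb, zero_mul]
      positivity
end

section
/- There exists a non-degenerate ranking problem such that for every strictly increasing concave function g : ℝ → ℝ, every ranking policy π maximizing the diversity D(π) over all ranking policies satisfies U(π|UG) = 0 for some user group UG. -/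
open Finset

/-- Two items, two intents, two user groups; item `b` is relevant exactly to intent `b`, user
group `b` has intent `b`, and only the first position has exposure. -/
noncomputable def exP : RankingProblem where
  Item := Bool
  Intent := Bool
  UserGrp := Bool
  ItemGrp := Bool
  ρ := fun b => if b then 2/3 else 1/3
  ρ_nonneg := by intro b; cases b <;> norm_num
  ρ_sum := by norm_num
  grp := id
  grp_surj := Function.surjective_id
  intentDist := fun b i => if b = i then 1 else 0
  intentDist_nonneg := by intro b i; split_ifs <;> norm_num
  intentDist_sum := by intro b; simp
  rel := fun b i => if b = i then 1 else 0
  rel_nonneg := by intro b i; split_ifs <;> norm_num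
  expo := fun n => if n.val = 0 then 1 else 0
  expo_nonneg := by intro n; split_ifs <;> norm_num
  expo_sum_pos := by
    apply Finset.sum_pos'
    · intro n _; split_ifs <;> norm_num
    · exact ⟨⟨0, by simp⟩, Finset.mem_univ _, by simp⟩

lemma exP_overall (i : Bool) : exP.overallIntent i = if i then 2/3 else 1/3 := by
  change ∑ b : Bool, (if b then (2/3:ℝ) else 1/3) * (if b = i then 1 else 0) = _
  cases i <;> simp

lemma exP_util (σ : exP.Ranking) (i : Bool) :
    exP.intentUtil σ i = if (σ i).val = 0 then 1 else 0 := by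
  change ∑ d : Bool, (if (σ d).val = 0 then (1:ℝ) else 0) * (if d = i then 1 else 0) = _
  cases i <;> simp

lemma exP_cases (σ : exP.Ranking) :
    ((σ true).val = 0 ∧ (σ false).val ≠ 0) ∨ ((σ true).val ≠ 0 ∧ (σ false).val = 0) := by
  have h1 : (σ true).val < 2 := (σ true).isLt
  have h2 : (σ false).val < 2 := (σ false).isLt
  have h3 : (σ true).val ≠ (σ false).val := by
    intro h
    have h4 : (true : Bool) = false := σ.injective (Fin.ext h)
    cases h4
  omega

lemma exP_div (g : ℝ → ℝ) (σ : exP.Ranking) :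
    exP.rankDiversity g σ =
      if (σ true).val = 0 then 2/3 * g 1 + 1/3 * g 0 else 2/3 * g 0 + 1/3 * g 1 := by
  change ∑ i : Bool, exP.overallIntent i * g (exP.intentUtil σ i) = _
  simp only [Fintype.sum_bool, exP_overall, exP_util]
  rcases exP_cases σ with ⟨h1, h2⟩ | ⟨h1, h2⟩ <;> simp [h1, h2]

lemma exP_exists : ∃ σ : exP.Ranking, (σ true).val = 0 := by
  let τ : exP.Ranking := Fintype.equivFin exP.Item
  rcases exP_cases τ with h | h
  · exact ⟨τ, h.1⟩
  · refine ⟨(Equiv.boolNot : Bool ≃ Bool).trans τ, ?_⟩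
    exact h.2

/-- There exists a non-degenerate ranking problem such that for every strictly
increasing concave g, every diversity-maximizing policy gives zero utility to some
user group. -/
theorem stmt17 :
    ∃ P : RankingProblem, P.NonDegenerate ∧
      ∀ g : ℝ → ℝ, StrictMono g → ConcaveOn ℝ Set.univ g →
        ∀ π : P.Ranking → ℝ, P.MaxDiv g π → ∃ ug, P.groupUtil π ug = 0 := by
  refine ⟨exP, ⟨?_, ?_, ?_, ?_⟩, ?_⟩
  · change ∀ b : Bool, (0:ℝ) < if b = true then 2/3 else 1/3
    intro b
    split_ifs <;> norm_num
  · intro i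
    refine lt_of_lt_of_eq ?_ (exP_overall i).symm
    split_ifs <;> norm_num
  · change ∀ i : Bool, ∃ d : Bool, (0:ℝ) < if d = i then 1 else 0
    intro i
    exact ⟨i, by simp⟩
  · change ∀ b : Bool, ∃ d : Bool, d = b ∧
      0 < ∑ i : Bool, exP.overallIntent i * (if d = i then (1:ℝ) else 0)
    intro b
    refine ⟨b, rfl, ?_⟩
    simp only [Fintype.sum_bool, exP_overall]
    cases b <;> norm_num
  · intro g hg _ π hπ
    obtain ⟨⟨hnn, hsum⟩, hmax⟩ := hπ
    have h01 : g 0 < g 1 := hg (by norm_num)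
    obtain ⟨σ₀, hσ₀⟩ := exP_exists
    classical
    have hpol : exP.IsPolicy (fun σ => if σ = σ₀ then 1 else 0) :=
      ⟨fun σ => by dsimp only; split_ifs <;> norm_num, by simp⟩
    have hm := hmax _ hpol
    have hD : exP.diversity g (fun σ => if σ = σ₀ then 1 else 0) = 2/3 * g 1 + 1/3 * g 0 := by
      have h : exP.diversity g (fun σ => if σ = σ₀ then 1 else 0) = exP.rankDiversity g σ₀ := by
        simp [RankingProblem.diversity]
      rw [h, exP_div, if_pos hσ₀]
    rw [hD] at hm
    set M : ℝ := 2/3 * g 1 + 1/3 * g 0 with hM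
    have hle : ∀ σ, 0 ≤ π σ * (M - exP.rankDiversity g σ) := by
      intro σ
      refine mul_nonneg (hnn σ) ?_
      rw [exP_div]
      split_ifs <;> linarith
    have hs : ∑ σ, π σ * (M - exP.rankDiversity g σ) = M - exP.diversity g π := by
      simp only [mul_sub, Finset.sum_sub_distrib, ← Finset.sum_mul, hsum, one_mul,
        RankingProblem.diversity]
    have h0 : ∑ σ, π σ * (M - exP.rankDiversity g σ) = 0 :=
      le_antisymm (by rw [hs]; linarith) (Finset.sum_nonneg fun σ _ => hle σ)
    have hz := (Finset.sum_eq_zero_iff_of_nonneg (fun σ _ => hle σ)).1 h0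
    refine ⟨false, ?_⟩
    refine Finset.sum_eq_zero fun σ _ => ?_
    have hzσ := hz σ (Finset.mem_univ _)
    have hU : ∑ i, exP.intentDist false i * exP.intentUtil σ i = exP.intentUtil σ false := by
      change ∑ i : Bool, (if false = i then (1:ℝ) else 0) * exP.intentUtil σ i = _
      simp
    rw [hU, exP_util]
    rcases exP_cases σ with ⟨h1, h2⟩ | ⟨h1, h2⟩
    · simp [h2]
    · rw [exP_div, if_neg h1] at hzσ
      rcases mul_eq_zero.1 hzσ with h | h
      · simp [h]
      · exfalso; linarith
end
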